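/- arXiv:2505.01828 — 6 statements merged into one kernel-verified Lean document; each statement's English description precedes it below -/
import Mathlib

section
/- Let v₀ ∈ ℝ^n, let (d_k)_{k≥0} be an arbitrary sequence of probability vectors in ℝ^n, and define the R1-VI iterates by v_{k+1} = T(v_k) + (γ/(1−γ)) ⟨d_k, T(v_k) − v_k⟩ 𝟙 for k = 0,1,…. If v⋆ ∈ ℝ^n satisfies T(v⋆) = v⋆, then for every k ≥ 0, ‖v_{k+1} − v⋆‖∞ ≤ γ^{k+1} ( ‖v₀ − v⋆‖∞ + (1/(1−γ)) ‖T(v₀) − v₀‖∞ ). In particular, the iterates converge to v⋆ linearly with rate γ. -/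
open Filter Topology

/-- The Bellman operator is monotone and discounts constant shifts by `γ`. -/
theorem bellman_le_add {S A : Type*} [Fintype S] [Fintype A] [Nonempty A]
    {P : S → A → S → ℝ} (hP0 : ∀ s a s', 0 ≤ P s a s') (hP1 : ∀ s a, ∑ s', P s a s' = 1)
    {c : S → A → ℝ} {γ : ℝ} (hγ : 0 ≤ γ) {T : (S → ℝ) → (S → ℝ)}
    (hT : ∀ v s, T v s = ⨅ a, (c s a + γ * ∑ s', P s a s' * v s'))
    {v w : S → ℝ} {t : ℝ} (h : ∀ s, v s ≤ w s + t) (s : S) : T v s ≤ T w s + γ * t := by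
  rw [← sub_le_iff_le_add, hT w]
  refine le_ciInf fun a => ?_
  have h1 : T v s ≤ c s a + γ * ∑ s', P s a s' * v s' :=
    hT v s ▸ ciInf_le (Set.finite_range _).bddBelow a
  have h2 : ∑ s', P s a s' * v s' ≤ ∑ s', P s a s' * w s' + t := calc
    _ ≤ ∑ s', P s a s' * (w s' + t) :=
      Finset.sum_le_sum fun s' _ => mul_le_mul_of_nonneg_left (h s') (hP0 s a s')
    _ = _ := by simp only [mul_add, Finset.sum_add_distrib, ← Finset.sum_mul, hP1, one_mul]
  nlinarith [mul_le_mul_of_nonneg_left h2 hγ]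

/-- A weighted average is bounded by the sup norm. -/
theorem abs_sum_mul_le_norm {S : Type*} [Fintype S] {d : S → ℝ} (hd0 : ∀ s, 0 ≤ d s)
    (hd1 : ∑ s, d s = 1) (x : S → ℝ) : |∑ s, d s * x s| ≤ ‖x‖ := calc
  _ ≤ ∑ s, |d s * x s| := Finset.abs_sum_le_sum_abs _ _
  _ ≤ ∑ s, d s * ‖x‖ := Finset.sum_le_sum fun s _ => by
    rw [abs_mul, abs_of_nonneg (hd0 s)]
    exact mul_le_mul_of_nonneg_left (norm_le_pi_norm x s) (hd0 s)
  _ = ‖x‖ := by rw [← Finset.sum_mul, hd1, one_mul]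

/-- Each iterate is a value iteration iterate up to a constant shift. -/
theorem rankOne_iterate_succ_eq {S : Type*} [Fintype S] {γ : ℝ} (hγ : γ < 1)
    {T : (S → ℝ) → (S → ℝ)} (hshift : ∀ v t, T (fun s => v s + t) = fun s => T v s + γ * t)
    {d : ℕ → S → ℝ} (hd1 : ∀ k, ∑ s, d k s = 1) {v : ℕ → S → ℝ}
    (hv : ∀ k, v (k + 1) =
      fun s => T (v k) s + γ / (1 - γ) * (∑ s', d k s' * (T (v k) s' - v k s'))) (k : ℕ) :
    v (k + 1) = fun s => T^[k + 1] (v 0) s +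
      γ / (1 - γ) * ∑ s', d k s' * (T^[k + 1] (v 0) - T^[k] (v 0)) s' := by
  have key : ∀ k t, v k = (fun s => T^[k] (v 0) s + t) → v (k + 1) = fun s =>
      T^[k + 1] (v 0) s + γ / (1 - γ) * ∑ s', d k s' * (T^[k + 1] (v 0) - T^[k] (v 0)) s' := by
    intro k t hk
    have hsum : ∑ s', d k s' * (T (v k) s' - v k s') =
        ∑ s', d k s' * (T^[k + 1] (v 0) - T^[k] (v 0)) s' - (1 - γ) * t := by
      have hconst : (1 - γ) * t = ∑ s', d k s' * ((1 - γ) * t) := by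
        rw [← Finset.sum_mul, hd1, one_mul]
      rw [hconst, hk, hshift, ← Function.iterate_succ_apply' T, ← Finset.sum_sub_distrib]
      refine Finset.sum_congr rfl fun s _ => ?_
      simp only [Pi.sub_apply, Nat.succ_eq_add_one]
      ring
    have hne : 1 - γ ≠ 0 := by linarith
    rw [hv k, hsum, hk, hshift, ← Function.iterate_succ_apply' T]
    funext s
    field_simp
    ring
  induction k with
  | zero => exact key 0 0 (by simp)
  | succ k ih => exact key (k + 1) _ ih

/-- Convergence of R1-VI: for any sequence of probability vectors
`d k`, the R1-VI iterates satisfy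
`‖v (k+1) - v⋆‖∞ ≤ γ^(k+1) (‖v 0 - v⋆‖∞ + (1/(1-γ)) ‖T (v 0) - v 0‖∞)`,
and in particular converge to the fixed point `v⋆` of `T`. -/
theorem stmt3 {S A : Type*} [Fintype S] [Nonempty S] [Fintype A] [Nonempty A]
    (P : S → A → S → ℝ)
    (hP0 : ∀ s a s', 0 ≤ P s a s')
    (hP1 : ∀ s a, ∑ s', P s a s' = 1)
    (c : S → A → ℝ) (γ : ℝ) (hγ : γ ∈ Set.Ioo (0 : ℝ) 1)
    (T : (S → ℝ) → (S → ℝ))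
    (hT : ∀ v s, T v s = ⨅ a, (c s a + γ * ∑ s', P s a s' * v s'))
    (d : ℕ → S → ℝ) (hd0 : ∀ k s, 0 ≤ d k s) (hd1 : ∀ k, ∑ s, d k s = 1)
    (v : ℕ → S → ℝ)
    (hv : ∀ k, v (k + 1) =
      fun s => T (v k) s + γ / (1 - γ) * (∑ s', d k s' * (T (v k) s' - v k s')))
    (vstar : S → ℝ) (hvstar : T vstar = vstar) :
    (∀ k, ‖v (k + 1) - vstar‖ ≤
        γ ^ (k + 1) * (‖v 0 - vstar‖ + 1 / (1 - γ) * ‖T (v 0) - v 0‖)) ∧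
      Tendsto v atTop (𝓝 vstar) := by
  obtain ⟨hγ0, hγ1⟩ := hγ
  have hle {v w : S → ℝ} {t : ℝ} := bellman_le_add hP0 hP1 hγ0.le hT (v := v) (w := w) (t := t)
  have hlip : LipschitzWith (NNReal.mk γ hγ0.le) T := LipschitzWith.of_dist_le_mul fun v w => by
    have habs := fun s => abs_le.1 (norm_le_pi_norm (v - w) s)
    simp only [Pi.sub_apply] at habs
    rw [dist_eq_norm, dist_eq_norm, NNReal.coe_mk,
      pi_norm_le_iff_of_nonneg (mul_nonneg hγ0.le (norm_nonneg _))]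
    intro s
    rw [Pi.sub_apply, Real.norm_eq_abs, abs_sub_le_iff, sub_le_iff_le_add', sub_le_iff_le_add']
    exact ⟨hle (fun s => by linarith [(habs s).2]) s, hle (fun s => by linarith [(habs s).1]) s⟩
  have hshift : ∀ v t, T (fun s => v s + t) = fun s => T v s + γ * t := fun v t => by
    funext s
    refine le_antisymm (hle (fun _ => le_rfl) s) ?_
    have := hle (v := v) (w := fun s => v s + t) (t := -t) (fun s => by simp) s
    linarith
  have hiter (k : ℕ) (x y : S → ℝ) : ‖T^[k] x - T^[k] y‖ ≤ γ ^ k * ‖x - y‖ := by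
    simpa only [dist_eq_norm, NNReal.coe_pow, NNReal.coe_mk] using (hlip.iterate k).dist_le_mul x y
  have hbound : ∀ k, ‖v (k + 1) - vstar‖ ≤
      γ ^ (k + 1) * (‖v 0 - vstar‖ + 1 / (1 - γ) * ‖T (v 0) - v 0‖) := by
    intro k
    have hstar := hiter (k + 1) (v 0) vstar
    rw [Function.iterate_fixed hvstar] at hstar
    have havg := (abs_sum_mul_le_norm (hd0 k) (hd1 k) (T^[k + 1] (v 0) - T^[k] (v 0))).trans
      (hiter k (T (v 0)) (v 0))
    have hcoef : 0 ≤ γ / (1 - γ) := div_nonneg hγ0.le (by linarith)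
    rw [rankOne_iterate_succ_eq hγ1 hshift hd1 hv k]
    set u := T^[k + 1] (v 0)
    set a := ∑ s', d k s' * (u - T^[k] (v 0)) s'
    calc ‖(fun s => u s + γ / (1 - γ) * a) - vstar‖
        = ‖(u - vstar) + fun _ => γ / (1 - γ) * a‖ := by
          congr 1
          funext s
          simp only [Pi.sub_apply, Pi.add_apply]
          ring
      _ ≤ ‖u - vstar‖ + γ / (1 - γ) * |a| := by
          refine (norm_add_le _ _).trans_eq ?_
          rw [pi_norm_const, norm_mul, Real.norm_of_nonneg hcoef, Real.norm_eq_abs]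
      _ ≤ γ ^ (k + 1) * ‖v 0 - vstar‖ + γ / (1 - γ) * (γ ^ k * ‖T (v 0) - v 0‖) := by gcongr
      _ = _ := by ring
  refine ⟨hbound, (tendsto_add_atTop_iff_nat 1).1 (tendsto_iff_norm_sub_tendsto_zero.2 ?_)⟩
  refine squeeze_zero (fun _ => norm_nonneg _) hbound ?_
  simpa using ((tendsto_pow_atTop_nhds_zero_of_lt_one hγ0.le hγ1).comp
    (tendsto_add_atTop_nat 1)).mul_const (‖v 0 - vstar‖ + 1 / (1 - γ) * ‖T (v 0) - v 0‖)
end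

section
/- Let v₀ ∈ ℝ^n, let (d_k)_{k≥0} be probability vectors in ℝ^n, and define the R1-VI iterates v_{k+1} = T(v_k) + α_k 𝟙 with α_k = (γ/(1−γ)) ⟨d_k, T(v_k) − v_k⟩. Define β₀ = 0 and β_{k+1} = γβ_k + α_k. Then for every k ≥ 0, v_{k+1} = T^{(k+1)}(v₀) + β_{k+1} 𝟙, where T^{(k+1)} denotes the (k+1)-fold composition of T. -/
/-- A discounted Bellman operator maps a shift of the value function by a constant `b`
to a shift by `γ * b`. -/
theorem bellman_add_const {S A : Type*} [Fintype S] [Fintype A] [Nonempty A]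
    (P : S → A → S → ℝ) (hP1 : ∀ s a, ∑ s', P s a s' = 1)
    (c : S → A → ℝ) (γ : ℝ) (w : S → ℝ) (b : ℝ) (s : S) :
    (⨅ a, (c s a + γ * ∑ s', P s a s' * (w s' + b))) =
      (⨅ a, (c s a + γ * ∑ s', P s a s' * w s')) + γ * b := by
  rw [ciInf_add (Set.finite_range _).bddBelow]
  congr 1
  funext a
  simp only [mul_add, Finset.sum_add_distrib, ← Finset.sum_mul, hP1]
  ring

/-- The R1-VI iterates `v (k+1) = T (v k) + α k 𝟙` with
`α k = (γ/(1-γ)) ⟨d k, T (v k) - v k⟩` satisfy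
`v (k+1) = T^(k+1) (v 0) + β (k+1) 𝟙` where `β 0 = 0`, `β (k+1) = γ β k + α k`. -/
theorem stmt5 {S A : Type*} [Fintype S] [Nonempty S] [Fintype A] [Nonempty A]
    (P : S → A → S → ℝ)
    (hP0 : ∀ s a s', 0 ≤ P s a s')
    (hP1 : ∀ s a, ∑ s', P s a s' = 1)
    (c : S → A → ℝ) (γ : ℝ) (hγ : γ ∈ Set.Ioo (0 : ℝ) 1)
    (T : (S → ℝ) → (S → ℝ))
    (hT : ∀ v s, T v s = ⨅ a, (c s a + γ * ∑ s', P s a s' * v s'))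
    (d : ℕ → S → ℝ) (hd0 : ∀ k s, 0 ≤ d k s) (hd1 : ∀ k, ∑ s, d k s = 1)
    (v : ℕ → S → ℝ) (α β : ℕ → ℝ)
    (hα : ∀ k, α k = γ / (1 - γ) * ∑ s, d k s * (T (v k) s - v k s))
    (hv : ∀ k, v (k + 1) = fun s => T (v k) s + α k)
    (hβ0 : β 0 = 0)
    (hβ : ∀ k, β (k + 1) = γ * β k + α k) :
    ∀ k, v (k + 1) = fun s => T^[k + 1] (v 0) s + β (k + 1) := by
  have key : ∀ k, v k = fun s => T^[k] (v 0) s + β k := by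
    intro k
    induction k with
    | zero => simp [hβ0]
    | succ k ih =>
      funext s
      rw [hv k, Function.iterate_succ_apply', hβ k]
      have hshift : T (v k) s = T (T^[k] (v 0)) s + γ * β k := by
        rw [ih, hT, hT (T^[k] (v 0))]
        exact bellman_add_const P hP1 c γ _ _ s
      simp only [hshift]
      ring
  exact fun k => key (k + 1)
end

section
/- Let (σ_k)_{k≥0} be sample maps S×A → S, (λ_k)_{k≥0} nonnegative step sizes, and (d̂_k)_{k≥0} probability vectors on S×A. Starting from a common q₀ ∈ ℝ^{S×A}, define the QL iterates q^{QL}_{k+1} = (1−λ_k) q^{QL}_k + λ_k T̂_{σ_k}(q^{QL}_k) and the R1-QL iterates q_{k+1} = (1−λ_k) q_k + λ_k T̂_{σ_k}(q_k) + α_k 𝟙 with α_k = λ_k (γ/(1−γ)) ⟨d̂_k, T̂_{σ_k}(q_k) − q_k⟩. Define β₀ = 0 and β_{k+1} = (1−λ_k)β_k + γλ_kβ_k + α_k. Then for every k ≥ 0, q_k = q^{QL}_k + β_k 𝟙. -/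
/-- The coupled QL and R1-QL iterates satisfy
`q k = qQL k + β k 𝟙` for every `k`. -/
theorem stmt11 {S A : Type*} [Fintype S] [Nonempty S] [Fintype A] [Nonempty A]
    (c : S → A → ℝ) (γ : ℝ) (hγ : γ ∈ Set.Ioo (0 : ℝ) 1)
    (That : (S × A → S) → (S × A → ℝ) → (S × A → ℝ))
    (hThat : ∀ σ q s a, That σ q (s, a) = c s a + γ * ⨅ a', q (σ (s, a), a'))
    (σ : ℕ → S × A → S)
    (lam : ℕ → ℝ) (hlam : ∀ k, 0 ≤ lam k)
    (d : ℕ → S × A → ℝ) (hd0 : ∀ k x, 0 ≤ d k x) (hd1 : ∀ k, ∑ x, d k x = 1)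
    (q qQL : ℕ → S × A → ℝ) (α β : ℕ → ℝ)
    (hq0 : qQL 0 = q 0)
    (hqQL : ∀ k, qQL (k + 1) =
      fun x => (1 - lam k) * qQL k x + lam k * That (σ k) (qQL k) x)
    (hα : ∀ k, α k = lam k * (γ / (1 - γ)) * ∑ x, d k x * (That (σ k) (q k) x - q k x))
    (hq : ∀ k, q (k + 1) =
      fun x => (1 - lam k) * q k x + lam k * That (σ k) (q k) x + α k)
    (hβ0 : β 0 = 0)
    (hβ : ∀ k, β (k + 1) = (1 - lam k) * β k + γ * lam k * β k + α k) :
    ∀ k, q k = fun x => qQL k x + β k := by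
  intro k
  induction k with
  | zero => funext x; simp [hq0, hβ0]
  | succ k ih =>
    funext ⟨s, a⟩
    have hmin : (⨅ a', q k (σ k (s, a), a')) = (⨅ a', qQL k (σ k (s, a), a')) + β k := by
      rw [ih, ciInf_add (Set.finite_range _).bddBelow]
    have hcur : q k (s, a) = qQL k (s, a) + β k := congrFun ih (s, a)
    rw [hq, hqQL, hβ]
    simp only [hThat]
    rw [hmin, hcur]
    ring
end

section
/- In the setting of the coupled QL and R1-QL iterates (common initialization q₀, sample maps σ_k, step sizes λ_k ≥ 0, probability vectors d̂_k, α_k = λ_k (γ/(1−γ)) ⟨d̂_k, T̂_{σ_k}(q_k) − q_k⟩, β₀ = 0, β_{k+1} = (1−λ_k)β_k + γλ_kβ_k + α_k), for every k ≥ 0 one has α_k = λ_k (γ/(1−γ)) ⟨d̂_k, T̂_{σ_k}(q^{QL}_k) − q^{QL}_k⟩ − γλ_kβ_k. -/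
/-- Translating an action-value function by a constant `b` translates its image under an
empirical Bellman operator by `γ * b`. -/
lemma empiricalBellman_add_const {S A : Type*} [Finite A] [Nonempty A]
    {c : S → A → ℝ} {γ : ℝ} {That : (S × A → S) → (S × A → ℝ) → (S × A → ℝ)}
    (hThat : ∀ σ q s a, That σ q (s, a) = c s a + γ * ⨅ a', q (σ (s, a), a'))
    (σ : S × A → S) (q : S × A → ℝ) (b : ℝ) (x : S × A) :
    That σ (fun y => q y + b) x = That σ q x + γ * b := by
  obtain ⟨s, a⟩ := x
  rw [hThat, hThat, ← ciInf_add (Set.finite_range _).bddBelow b]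
  ring


/-- The coupled QL and R1-QL iterates satisfy
`α k = λ_k (γ/(1-γ)) ⟨d̂ k, T̂ (qQL k) - qQL k⟩ - γ λ_k β k` for every `k`. -/
theorem stmt12 {S A : Type*} [Fintype S] [Nonempty S] [Fintype A] [Nonempty A]
    (c : S → A → ℝ) (γ : ℝ) (hγ : γ ∈ Set.Ioo (0 : ℝ) 1)
    (That : (S × A → S) → (S × A → ℝ) → (S × A → ℝ))
    (hThat : ∀ σ q s a, That σ q (s, a) = c s a + γ * ⨅ a', q (σ (s, a), a'))
    (σ : ℕ → S × A → S)
    (lam : ℕ → ℝ) (hlam : ∀ k, 0 ≤ lam k)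
    (d : ℕ → S × A → ℝ) (hd0 : ∀ k x, 0 ≤ d k x) (hd1 : ∀ k, ∑ x, d k x = 1)
    (q qQL : ℕ → S × A → ℝ) (α β : ℕ → ℝ)
    (hq0 : qQL 0 = q 0)
    (hqQL : ∀ k, qQL (k + 1) =
      fun x => (1 - lam k) * qQL k x + lam k * That (σ k) (qQL k) x)
    (hα : ∀ k, α k = lam k * (γ / (1 - γ)) * ∑ x, d k x * (That (σ k) (q k) x - q k x))
    (hq : ∀ k, q (k + 1) =
      fun x => (1 - lam k) * q k x + lam k * That (σ k) (q k) x + α k)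
    (hβ0 : β 0 = 0)
    (hβ : ∀ k, β (k + 1) = (1 - lam k) * β k + γ * lam k * β k + α k) :
    ∀ k, α k = lam k * (γ / (1 - γ)) * (∑ x, d k x * (That (σ k) (qQL k) x - qQL k x))
      - γ * lam k * β k := by
  have hshift : ∀ k, q k = fun x => qQL k x + β k := by
    intro k
    induction k with
    | zero => simp [hq0, hβ0]
    | succ k ih =>
      funext x
      rw [hq, hqQL, hβ, ih]
      simp only [empiricalBellman_add_const hThat]
      ring
  intro k
  have hγ1 : 1 - γ ≠ 0 := (sub_pos.mpr hγ.2).ne'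
  have hsum : ∑ x, d k x * (That (σ k) (q k) x - q k x) =
      ∑ x, d k x * (That (σ k) (qQL k) x - qQL k x) - (1 - γ) * β k := by
    calc
      _ = ∑ x, (d k x * (That (σ k) (qQL k) x - qQL k x) - d k x * ((1 - γ) * β k)) := by
        refine Finset.sum_congr rfl fun x _ => ?_
        rw [hshift k, empiricalBellman_add_const hThat]
        ring
      _ = _ := by rw [Finset.sum_sub_distrib, ← Finset.sum_mul, hd1, one_mul]
  rw [hα, hsum]
  field_simp
end

section
/- In the setting of the coupled QL and R1-QL iterates (common initialization q₀, sample maps σ_k, step sizes λ_k ≥ 0, probability vectors d̂_k, α_k = λ_k (γ/(1−γ)) ⟨d̂_k, T̂_{σ_k}(q_k) − q_k⟩), the shift sequence defined by β₀ = 0, β_{k+1} = (1−λ_k)β_k + γλ_kβ_k + α_k satisfies the closed recursion β_{k+1} = (1−λ_k)β_k + λ_k (γ/(1−γ)) ⟨d̂_k, T̂_{σ_k}(q^{QL}_k) − q^{QL}_k⟩ for every k ≥ 0. -/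
/-- An operator of Bellman form maps a constant shift by `b` to a constant shift by `γ * b`. -/
theorem bellman_add_const_s13 {S A : Type*} [Finite A] [Nonempty A]
    {c : S → A → ℝ} {γ : ℝ} {T : (S × A → S) → (S × A → ℝ) → (S × A → ℝ)}
    (hT : ∀ σ q s a, T σ q (s, a) = c s a + γ * ⨅ a', q (σ (s, a), a'))
    (σ : S × A → S) {p q : S × A → ℝ} {b : ℝ} (h : ∀ x, p x = q x + b) (x : S × A) :
    T σ p x = T σ q x + γ * b := by
  obtain ⟨s, a⟩ := x
  simp only [hT, h]
  rw [← ciInf_add (Set.finite_range _).bddBelow]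
  ring

/-- The coupled QL and R1-QL iterates satisfy
the closed recursion `β (k+1) = (1-λ_k) β k + λ_k (γ/(1-γ)) ⟨d̂ k, T̂ (qQL k) - qQL k⟩`. -/
theorem stmt13 {S A : Type*} [Fintype S] [Nonempty S] [Fintype A] [Nonempty A]
    (c : S → A → ℝ) (γ : ℝ) (hγ : γ ∈ Set.Ioo (0 : ℝ) 1)
    (That : (S × A → S) → (S × A → ℝ) → (S × A → ℝ))
    (hThat : ∀ σ q s a, That σ q (s, a) = c s a + γ * ⨅ a', q (σ (s, a), a'))
    (σ : ℕ → S × A → S)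
    (lam : ℕ → ℝ) (hlam : ∀ k, 0 ≤ lam k)
    (d : ℕ → S × A → ℝ) (hd0 : ∀ k x, 0 ≤ d k x) (hd1 : ∀ k, ∑ x, d k x = 1)
    (q qQL : ℕ → S × A → ℝ) (α β : ℕ → ℝ)
    (hq0 : qQL 0 = q 0)
    (hqQL : ∀ k, qQL (k + 1) =
      fun x => (1 - lam k) * qQL k x + lam k * That (σ k) (qQL k) x)
    (hα : ∀ k, α k = lam k * (γ / (1 - γ)) * ∑ x, d k x * (That (σ k) (q k) x - q k x))
    (hq : ∀ k, q (k + 1) =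
      fun x => (1 - lam k) * q k x + lam k * That (σ k) (q k) x + α k)
    (hβ0 : β 0 = 0)
    (hβ : ∀ k, β (k + 1) = (1 - lam k) * β k + γ * lam k * β k + α k) :
    ∀ k, β (k + 1) = (1 - lam k) * β k +
      lam k * (γ / (1 - γ)) * (∑ x, d k x * (That (σ k) (qQL k) x - qQL k x)) := by
  have shift : ∀ k x, q k x = qQL k x + β k := by
    intro k
    induction k with
    | zero => simp [hq0, hβ0]
    | succ k ih =>
      intro x
      rw [hq, hqQL, hβ]
      simp only [bellman_add_const_s13 hThat (σ k) ih, ih]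
      ring
  intro k
  have residual : ∑ x, d k x * (That (σ k) (q k) x - q k x) =
      ∑ x, d k x * (That (σ k) (qQL k) x - qQL k x) - (1 - γ) * β k := by
    have average : ∑ x, d k x * ((1 - γ) * β k) = (1 - γ) * β k := by
      rw [← Finset.sum_mul, hd1, one_mul]
    rw [← average, ← Finset.sum_sub_distrib]
    refine Finset.sum_congr rfl fun x _ => ?_
    rw [bellman_add_const_s13 hThat (σ k) (shift k), shift k x]
    ring
  have hγ_ne : 1 - γ ≠ 0 := sub_ne_zero.mpr hγ.2.ne'
  rw [hβ, hα, residual]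
  field_simp
  ring
end

section
/- Consider the coupled QL and R1-QL iterates with step sizes λ_k = 1/(k+1): common initialization q₀ ∈ ℝ^{S×A}, sample maps σ_k, probability vectors d̂_k on S×A, q^{QL}_{k+1} = (1−λ_k)q^{QL}_k + λ_k T̂_{σ_k}(q^{QL}_k), and q_{k+1} = (1−λ_k)q_k + λ_k T̂_{σ_k}(q_k) + λ_k (γ/(1−γ)) ⟨d̂_k, T̂_{σ_k}(q_k) − q_k⟩ 𝟙. If the QL iterates converge pointwise to some q⋆ ∈ ℝ^{S×A} and the Cesàro averages (1/(k+1)) Σ_{ℓ=0}^{k} ⟨d̂_ℓ, T̂_{σ_ℓ}(q^{QL}_ℓ) − q^{QL}_ℓ⟩ converge to 0 as k → ∞, then the R1-QL iterates q_k also converge pointwise to q⋆. -/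
open Filter Topology

/-- A minimum over a finite action set commutes with adding a constant. -/
theorem iInf_add_const_of_finite {A : Type*} [Finite A] [Nonempty A] (f : A → ℝ) (r : ℝ) :
    ⨅ a, (f a + r) = (⨅ a, f a) + r :=
  (ciInf_add (Set.finite_range f).bddBelow r).symm

/-- The weighted Bellman error of a constant shift, when the operator contracts constants by `γ`. -/
theorem sum_weight_mul_sub_add_const {X : Type*} [Fintype X] (d u v : X → ℝ)
    (hd : ∑ x, d x = 1) (γ r : ℝ) :
    ∑ x, d x * ((u x + γ * r) - (v x + r)) = ∑ x, d x * (u x - v x) + (γ - 1) * r := by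
  have h : ∀ x, d x * ((u x + γ * r) - (v x + r)) = d x * (u x - v x) + d x * ((γ - 1) * r) :=
    fun x => by ring
  simp only [h, Finset.sum_add_distrib, ← Finset.sum_mul, hd, one_mul]

/-- If the QL iterates converge pointwise to `q⋆` and the Cesàro
averages of `⟨d̂ ℓ, T̂ (qQL ℓ) - qQL ℓ⟩` tend to zero, then the R1-QL iterates (with
step sizes `λ_k = 1/(k+1)`) also converge pointwise to `q⋆`. -/
theorem stmt15 {S A : Type*} [Fintype S] [Nonempty S] [Fintype A] [Nonempty A]
    (c : S → A → ℝ) (γ : ℝ) (hγ : γ ∈ Set.Ioo (0 : ℝ) 1)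
    (That : (S × A → S) → (S × A → ℝ) → (S × A → ℝ))
    (hThat : ∀ σ q s a, That σ q (s, a) = c s a + γ * ⨅ a', q (σ (s, a), a'))
    (σ : ℕ → S × A → S)
    (d : ℕ → S × A → ℝ) (hd0 : ∀ k x, 0 ≤ d k x) (hd1 : ∀ k, ∑ x, d k x = 1)
    (q qQL : ℕ → S × A → ℝ)
    (hq0 : qQL 0 = q 0)
    (hqQL : ∀ k, qQL (k + 1) = fun x =>
      (1 - 1 / ((k : ℝ) + 1)) * qQL k x + (1 / ((k : ℝ) + 1)) * That (σ k) (qQL k) x)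
    (hq : ∀ k, q (k + 1) = fun x =>
      (1 - 1 / ((k : ℝ) + 1)) * q k x + (1 / ((k : ℝ) + 1)) * That (σ k) (q k) x +
        (1 / ((k : ℝ) + 1)) * (γ / (1 - γ)) *
          (∑ y, d k y * (That (σ k) (q k) y - q k y)))
    (qstar : S × A → ℝ)
    (hconv : ∀ x, Tendsto (fun k => qQL k x) atTop (𝓝 (qstar x)))
    (hCesaro : Tendsto (fun k : ℕ => (1 / ((k : ℝ) + 1)) *
        ∑ l ∈ Finset.range (k + 1),
          ∑ x, d l x * (That (σ l) (qQL l) x - qQL l x)) atTop (𝓝 0)) :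
    ∀ x, Tendsto (fun k => q k x) atTop (𝓝 (qstar x)) := by
  have hγ1 : 1 - γ ≠ 0 := (sub_pos.mpr hγ.2).ne'
  have hshift : ∀ (τ : S × A → S) (p : S × A → ℝ) (r : ℝ) (x : S × A),
      That τ (fun y => p y + r) x = That τ p x + γ * r := by
    rintro τ p r ⟨s, a⟩
    rw [hThat, hThat, iInf_add_const_of_finite]
    ring
  set b : ℕ → ℝ := fun l => ∑ x, d l x * (That (σ l) (qQL l) x - qQL l x)
  have hdiff : ∀ k : ℕ, q k = fun x =>
      qQL k x + γ / (1 - γ) * (1 / (k : ℝ) * ∑ l ∈ Finset.range k, b l) := by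
    intro k
    induction k with
    | zero => simp [hq0]
    | succ k ih =>
      set r : ℝ := γ / (1 - γ) * (1 / (k : ℝ) * ∑ l ∈ Finset.range k, b l) with hr
      have hkr : (k : ℝ) * r = γ / (1 - γ) * ∑ l ∈ Finset.range k, b l := by
        rcases Nat.eq_zero_or_pos k with rfl | hk
        · simp
        · have : (k : ℝ) ≠ 0 := by positivity
          rw [hr]
          field_simp
      have hk1 : (k : ℝ) + 1 ≠ 0 := by positivity
      have hsum : ∑ y, d k y * (That (σ k) (q k) y - q k y) = b k + (γ - 1) * r := by
        rw [ih]
        simp only [hshift]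
        exact sum_weight_mul_sub_add_const (d k) _ _ (hd1 k) γ r
      have hcancel : γ / (1 - γ) * (γ - 1) = -γ := by
        field_simp
        ring
      funext x
      rw [hq k]
      simp only [hsum]
      rw [ih, hshift, hqQL k, Finset.sum_range_succ]
      push_cast
      generalize γ / (1 - γ) = g at hkr hcancel ⊢
      generalize ∑ l ∈ Finset.range k, b l = B at hkr ⊢
      field_simp
      linear_combination hkr + r * hcancel
  intro x
  refine (tendsto_add_atTop_iff_nat 1).mp ?_
  have hlim := ((tendsto_add_atTop_iff_nat 1).mpr (hconv x)).add
    (hCesaro.const_mul (γ / (1 - γ)))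
  rw [mul_zero, add_zero] at hlim
  refine hlim.congr fun k => ?_
  rw [hdiff (k + 1)]
  push_cast
  rfl
end
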